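/- Let φ be a 3-CNF formula with clauses c_1, …, c_m (each clause a disjunction of exactly three literals) such that no clause contains both a literal and its negation. Then φ is satisfiable if and only if the graph G_φ (defined in the context, with the given edge-coloring and reload cost function) has a spanning tree T with reload diameter diam(T) ≤ 9. -/

import Mathlib

/-- The reload cost of a sequence of colors: sum of `c` over consecutive pairs. -/
def chainCost {X : Type*} (c : X → X → ℕ) : List X → ℕ
  | a :: b :: l => c a b + chainCost c (b :: l)
  | _ => 0

/-- The reload cost of a walk `p` in a graph with edge-coloring `χ` and reload cost
function `c` on colors. -/
def walkCost {V X : Type*} {G : SimpleGraph V} (χ : Sym2 V → X) (c : X → X → ℕ)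
    {u v : V} (p : G.Walk u v) : ℕ :=
  chainCost c (p.edges.map χ)

/-- Vertices of the graph `G_φ`: `none` is the distinguished vertex `r`, and
`some (j, i)` is the vertex `v^j_i` of the clause gadget of clause `j`. -/
abbrev Vphi (m : ℕ) := Option (Fin m × Fin 3)

/-- The edges of `G_φ`: `r` is joined to all `v^j_i`, and in each clause gadget there
are the edges `{v^j_1, v^j_2}` and `{v^j_2, v^j_3}`. -/
def GphiRel (m : ℕ) : Vphi m → Vphi m → Prop := fun a b =>
  (a = none ∧ b ≠ none) ∨
  (∃ (j : Fin m) (i i' : Fin 3), a = some (j, i) ∧ b = some (j, i') ∧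
    (i.val + 1 = i'.val ∨ i'.val + 1 = i.val))

def Gphi (m : ℕ) : SimpleGraph (Vphi m) := SimpleGraph.fromRel (GphiRel m)

open scoped Classical in
/-- The reload cost function of `G_φ`. Each edge has its own distinct color, so colors
are identified with (potential) edges, i.e., elements of `Sym2 (Vphi m)`.
Cost 10 between two spokes `{r, v^{j₁}_{i₁}}, {r, v^{j₂}_{i₂}}` carrying a literal and
its negation, 5 between two spokes otherwise, and 1 for any other pair. -/
noncomputable def phiCost {V : Type*} (m : ℕ) (lit : Fin m → Fin 3 → V × Bool)
    (e₁ e₂ : Sym2 (Vphi m)) : ℕ :=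
  if h₁ : ∃ p : Fin m × Fin 3, e₁ = s((none : Vphi m), some p) then
    if h₂ : ∃ q : Fin m × Fin 3, e₂ = s((none : Vphi m), some q) then
      if (lit h₁.choose.1 h₁.choose.2).1 = (lit h₂.choose.1 h₂.choose.2).1 ∧
          (lit h₁.choose.1 h₁.choose.2).2 ≠ (lit h₂.choose.1 h₂.choose.2).2
      then 10 else 5
    else 1
  else 1


theorem phiCost_spokes {V : Type*} (m : ℕ) (lit : Fin m → Fin 3 → V × Bool)
    (p q : Fin m × Fin 3) [Decidable ((lit p.1 p.2).1 = (lit q.1 q.2).1 ∧ (lit p.1 p.2).2 ≠ (lit q.1 q.2).2)] :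
    phiCost m lit s(none, some p) s(none, some q) =
      if (lit p.1 p.2).1 = (lit q.1 q.2).1 ∧ (lit p.1 p.2).2 ≠ (lit q.1 q.2).2 then 10 else 5 := by
  have h : ∀ p : Fin m × Fin 3, ∀ h : ∃ p' : Fin m × Fin 3, s((none : Vphi m), some p) = s((none : Vphi m), some p'),
      h.choose = p := by
    intro p h
    have := h.choose_spec
    simpa using this.symm
  unfold phiCost
  rw [dif_pos ⟨p, rfl⟩, dif_pos ⟨q, rfl⟩]
  simp only [h]

theorem phiCost_one {V : Type*} (m : ℕ) (lit : Fin m → Fin 3 → V × Bool)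
    (a b : Sym2 (Vphi m)) (h : ¬ ((none : Vphi m) ∈ a ∧ (none : Vphi m) ∈ b)) :
    phiCost m lit a b = 1 := by
  unfold phiCost
  split_ifs with h1 h2 h3
  · exfalso
    obtain ⟨p, rfl⟩ := h1
    obtain ⟨q, rfl⟩ := h2
    simp at h
  · exfalso
    obtain ⟨p, rfl⟩ := h1
    obtain ⟨q, rfl⟩ := h2
    simp at h
  · rfl
  · rfl

theorem chain_bound {X : Type*} (c : X → X → ℕ) (S : X → Prop) [DecidablePred S] (l : List X)
    (h5 : ∀ a ∈ l, ∀ b ∈ l, c a b ≤ 5)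
    (h1 : ∀ a ∈ l, ∀ b ∈ l, ¬ (S a ∧ S b) → c a b ≤ 1) :
    chainCost c l ≤ (l.length - 1) + 4 * (l.countP (fun x => decide (S x)) - 1) := by
  induction l with
  | nil => simp [chainCost]
  | cons a l ih =>
    cases l with
    | nil => simp [chainCost]
    | cons b l =>
      have ih' := ih (fun x hx y hy => h5 x (List.mem_cons_of_mem _ hx) y (List.mem_cons_of_mem _ hy))
        (fun x hx y hy => h1 x (List.mem_cons_of_mem _ hx) y (List.mem_cons_of_mem _ hy))
      have g5 := h5 a (by simp) b (by simp)
      have g1 := h1 a (by simp) b (by simp)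
      rw [chainCost]
      simp only [List.length_cons, List.countP_cons] at ih' ⊢
      by_cases ha : S a <;> by_cases hb : S b <;> simp [ha, hb] at ih' g1 ⊢ <;> omega

/-- the tree -/
def TRel (m : ℕ) (f : Fin m → Fin 3) : Vphi m → Vphi m → Prop := fun a b =>
  (∃ j, a = none ∧ b = some (j, f j)) ∨
  (∃ (j : Fin m) (i i' : Fin 3), a = some (j, i) ∧ b = some (j, i') ∧
    (i.val + 1 = i'.val ∨ i'.val + 1 = i.val))

/-- the tree -/
def TT (m : ℕ) (f : Fin m → Fin 3) : SimpleGraph (Vphi m) := SimpleGraph.fromRel (TRel m f)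

theorem TT_le (m : ℕ) (f : Fin m → Fin 3) : TT m f ≤ Gphi m := by
  have key : ∀ a b, TRel m f a b → GphiRel m a b := by
    rintro a b (⟨j, rfl, rfl⟩ | h)
    · left; simp
    · right; exact h
  intro a b h
  simp only [TT, Gphi, SimpleGraph.fromRel_adj] at h ⊢
  exact ⟨h.1, h.2.imp (key _ _) (key _ _)⟩

theorem TT_none (m : ℕ) (f : Fin m → Fin 3) (j i) :
    (TT m f).Adj none (some (j, i)) ↔ i = f j := by
  simp only [TT, SimpleGraph.fromRel_adj, TRel]
  constructor
  · rintro ⟨-, (⟨j', -, h⟩ | ⟨_, _, _, h, _⟩) | (⟨_, h, _⟩ | ⟨_, _, _, _, h, _⟩)⟩ <;> simp at h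
    obtain ⟨rfl, rfl⟩ := h; rfl
  · rintro rfl
    exact ⟨by simp, Or.inl (Or.inl ⟨j, by simp⟩)⟩

theorem TT_some (m : ℕ) (f : Fin m → Fin 3) (j i j' i') :
    (TT m f).Adj (some (j, i)) (some (j', i')) ↔
      j = j' ∧ (i.val + 1 = i'.val ∨ i'.val + 1 = i.val) := by
  simp only [TT, SimpleGraph.fromRel_adj, TRel]
  constructor
  · rintro ⟨-, (⟨_, h, _⟩ | ⟨_, _, _, h, h2, h3⟩) | (⟨_, h, _⟩ | ⟨_, _, _, h, h2, h3⟩)⟩ <;> simp at h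
    · simp at h2; obtain ⟨rfl, rfl⟩ := h; obtain ⟨rfl, rfl⟩ := h2
      exact ⟨rfl, h3⟩
    · simp at h2; obtain ⟨rfl, rfl⟩ := h; obtain ⟨rfl, rfl⟩ := h2
      exact ⟨rfl, h3.symm⟩
  · rintro ⟨rfl, h⟩
    refine ⟨?_, Or.inl (Or.inr ⟨j, i, i', rfl, rfl, h⟩)⟩
    intro h'
    simp at h'
    subst h'
    omega

theorem TT_conn (m : ℕ) (f : Fin m → Fin 3) : (TT m f).Connected := by
  have h01 : ∀ j, (TT m f).Reachable (some (j, 0)) (some (j, 1)) := fun j =>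
    SimpleGraph.Adj.reachable ((TT_some m f _ _ _ _).2 (by simp))
  have h12 : ∀ j, (TT m f).Reachable (some (j, 1)) (some (j, 2)) := fun j =>
    SimpleGraph.Adj.reachable ((TT_some m f _ _ _ _).2 (by simp))
  have h1 : ∀ j i, (TT m f).Reachable (some (j, 1)) (some (j, i)) := by
    intro j i
    fin_cases i
    · exact (h01 j).symm
    · exact SimpleGraph.Reachable.refl _
    · exact h12 j
  have hr : ∀ v, (TT m f).Reachable none v := by
    rintro (_ | ⟨j, i⟩)
    · exact SimpleGraph.Reachable.refl _
    · exact (SimpleGraph.Adj.reachable ((TT_none m f j (f j)).2 rfl)).trans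
        ((h1 j (f j)).symm.trans (h1 j i))
  haveI : Nonempty (Vphi m) := ⟨none⟩
  exact SimpleGraph.Connected.mk fun u v => (hr u).symm.trans (hr v)

theorem TT_tree (m : ℕ) (f : Fin m → Fin 3) : (TT m f).IsTree := by
  rw [SimpleGraph.isTree_iff_connected_and_card]
  refine ⟨TT_conn m f, le_antisymm ?_ (TT_conn m f).card_vert_le_card_edgeSet_add_one⟩
  let g : Fin m × Fin 3 → Sym2 (Vphi m) := fun x =>
    if x.2 = 0 then s(none, some (x.1, f x.1)) else
    if x.2 = 1 then s(some (x.1, 0), some (x.1, 1)) else s(some (x.1, 1), some (x.1, 2))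
  have hsub : (TT m f).edgeSet ⊆ Set.range g := by
    intro e
    induction e with
    | _ a b =>
      rw [SimpleGraph.mem_edgeSet]
      rcases a with _ | ⟨j, i⟩ <;> rcases b with _ | ⟨j', i'⟩
      · simp
      · rw [TT_none]; rintro rfl
        exact ⟨(j', 0), by simp [g]⟩
      · rw [SimpleGraph.adj_comm, TT_none]; rintro rfl
        exact ⟨(j, 0), by simp [g]⟩
      · rw [TT_some]; rintro ⟨rfl, h⟩
        fin_cases i <;> fin_cases i' <;> simp at h
        · exact ⟨(j, 1), by simp [g]⟩
        · exact ⟨(j, 1), by simp [g]⟩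
        · exact ⟨(j, 2), by simp [g]⟩
        · exact ⟨(j, 2), by simp [g]⟩
  have h1 : Nat.card (TT m f).edgeSet ≤ Nat.card (Set.range g) :=
    Nat.card_mono (Set.toFinite _) hsub
  have h2 : Nat.card (Set.range g) ≤ Nat.card (Fin m × Fin 3) := Finite.card_range_le g
  have h3 : Nat.card (Vphi m) = Nat.card (Fin m × Fin 3) + 1 := by simp
  omega

theorem TT_gadget (m : ℕ) (f : Fin m → Fin 3) {u v : Vphi m} (p : (TT m f).Walk u v)
    (hn : none ∉ p.support) (j : Fin m) (hu : ∃ i, u = some (j, i)) :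
    ∀ x ∈ p.support, ∃ i, x = some (j, i) := by
  induction p with
  | nil => simpa using hu
  | @cons u w v h q ih =>
    simp only [SimpleGraph.Walk.support_cons, List.mem_cons, not_or] at hn
    have hw : ∃ i, w = some (j, i) := by
      obtain ⟨i, rfl⟩ := hu
      rcases w with _ | ⟨j', i'⟩
      · exact absurd q.start_mem_support hn.2
      · rw [TT_some] at h
        exact ⟨i', by rw [h.1]⟩
    intro x hx
    simp only [SimpleGraph.Walk.support_cons, List.mem_cons] at hx
    rcases hx with rfl | hx
    · exact hu
    · exact ih hn.2 hw x hx

theorem TT_len (m : ℕ) (f : Fin m → Fin 3) {u v : Vphi m} (p : (TT m f).Walk u v)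
    (hn : none ∉ p.support) (hp : p.IsPath) : p.length ≤ 2 := by
  rcases u with _ | ⟨j, i⟩
  · exact absurd p.start_mem_support hn
  have h := TT_gadget m f p hn j ⟨i, rfl⟩
  have h2 : p.support.toFinset ⊆ Finset.univ.image (fun i : Fin 3 => (some (j, i) : Vphi m)) := by
    intro x hx
    obtain ⟨i, rfl⟩ := h x (by simpa using hx)
    simp
  have h3 := (Finset.card_le_card h2).trans Finset.card_image_le
  rw [List.toFinset_card_of_nodup hp.support_nodup] at h3
  simp at h3
  omega

theorem count_zero (m : ℕ) (f : Fin m → Fin 3) {u v : Vphi m} (p : (TT m f).Walk u v)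
    (hn : none ∉ p.support) : p.edges.countP (fun x => decide ((none : Vphi m) ∈ x)) = 0 := by
  rw [List.countP_eq_zero]
  intro e he h
  exact hn (SimpleGraph.Walk.mem_support_of_mem_edges he (by simpa using h))

theorem TT_root (m : ℕ) (f : Fin m → Fin 3) {v : Vphi m} (p : (TT m f).Walk none v)
    (hp : p.IsPath) : p.length ≤ 3 ∧
      p.edges.countP (fun x => decide ((none : Vphi m) ∈ x)) ≤ 1 := by
  cases p with
  | nil => simp
  | cons h q =>
    rw [SimpleGraph.Walk.cons_isPath_iff] at hp
    have h1 := TT_len m f q hp.2 hp.1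
    have h2 := count_zero m f q hp.2
    simp only [SimpleGraph.Walk.length_cons, SimpleGraph.Walk.edges_cons, List.countP_cons, h2]
    refine ⟨by omega, ?_⟩
    split_ifs <;> simp

theorem TT_all (m : ℕ) (f : Fin m → Fin 3) {u v : Vphi m} (p : (TT m f).Walk u v)
    (hp : p.IsPath) : p.length ≤ 6 ∧
      p.edges.countP (fun x => decide ((none : Vphi m) ∈ x)) ≤ 2 := by
  by_cases hn : none ∈ p.support
  · have h1 := TT_root m f _ (hp.takeUntil hn).reverse
    have h2 := TT_root m f _ (hp.dropUntil hn)
    rw [SimpleGraph.Walk.length_reverse, SimpleGraph.Walk.edges_reverse, List.countP_reverse] at h1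
    rw [← p.take_spec hn, SimpleGraph.Walk.length_append, SimpleGraph.Walk.edges_append,
      List.countP_append]
    omega
  · have h1 := TT_len m f p hn hp
    have h2 := count_zero m f p hn
    omega

theorem TT_spoke (m : ℕ) (f : Fin m → Fin 3) (e : Sym2 (Vphi m)) (he : e ∈ (TT m f).edgeSet)
    (hn : none ∈ e) : ∃ j, e = s(none, some (j, f j)) := by
  obtain ⟨b, rfl⟩ := Sym2.mem_iff_exists.1 hn
  rw [SimpleGraph.mem_edgeSet] at he
  rcases b with _ | ⟨j, i⟩
  · simp at he
  · rw [TT_none] at he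
    exact ⟨j, by rw [he]⟩

theorem TT_cost {V : Type*} (m : ℕ) (lit : Fin m → Fin 3 → V × Bool) (f : Fin m → Fin 3)
    (σ : V → Bool) (hf : ∀ j, σ (lit j (f j)).1 = (lit j (f j)).2)
    {u v : Vphi m} (p : (TT m f).Walk u v) (hp : p.IsPath) :
    walkCost id (phiCost m lit) p ≤ 9 := by
  classical
  unfold walkCost
  rw [List.map_id]
  have h := TT_all m f p hp
  have hb := chain_bound (phiCost m lit) (fun x => (none : Vphi m) ∈ x) p.edges ?_ ?_
  · rw [SimpleGraph.Walk.length_edges] at hb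
    omega
  · intro a ha b hb
    by_cases hs : (none : Vphi m) ∈ a ∧ (none : Vphi m) ∈ b
    · obtain ⟨j, rfl⟩ := TT_spoke m f a (p.edges_subset_edgeSet ha) hs.1
      obtain ⟨k, rfl⟩ := TT_spoke m f b (p.edges_subset_edgeSet hb) hs.2
      rw [phiCost_spokes, if_neg]
      rintro ⟨h1, h2⟩
      apply h2
      simp only at h1 ⊢
      rw [← hf, ← hf, h1]
    · rw [phiCost_one m lit a b hs]; norm_num
  · intro a _ b _ hs
    exact (phiCost_one m lit a b hs).le

/-- A 3-CNF formula `φ` (clause `j` is the disjunction of the three literals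
`lit j 0, lit j 1, lit j 2`, a literal being a variable paired with a sign) in which no
clause contains a literal and its negation is satisfiable if and only if `G_φ` has a
spanning tree of reload diameter at most `9`. -/
theorem stmt0 {V : Type*} (m : ℕ) (lit : Fin m → Fin 3 → V × Bool)
    (hnc : ∀ (j : Fin m) (i i' : Fin 3),
      (lit j i).1 = (lit j i').1 → (lit j i).2 = (lit j i').2) :
    (∃ σ : V → Bool, ∀ j : Fin m, ∃ i : Fin 3, σ (lit j i).1 = (lit j i).2) ↔
    (∃ T : SimpleGraph (Vphi m), T ≤ Gphi m ∧ T.IsTree ∧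
      ∀ (u v : Vphi m) (p : T.Walk u v), p.IsPath →
        walkCost id (phiCost m lit) p ≤ 9) := by
  classical
  constructor
  · rintro ⟨σ, hσ⟩
    choose f hf using hσ
    exact ⟨TT m f, TT_le m f, TT_tree m f, fun u v p hp => TT_cost m lit f σ hf p hp⟩
  · rintro ⟨T, hle, htree, hcost⟩
    have hspoke : ∀ j : Fin m, ∃ i : Fin 3, T.Adj none (some (j, i)) := by
      intro j
      obtain ⟨p⟩ := htree.1.preconnected (some (j, 0)) none
      obtain ⟨d, -, hd1, hd2⟩ := p.exists_boundary_dart {x | ∃ i, x = some (j, i)} ⟨0, rfl⟩ (by simp)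
      obtain ⟨i, hi⟩ := hd1
      have had := d.adj
      have hG := hle had
      refine ⟨i, ?_⟩
      have : d.snd = none := by
        rw [hi] at hG
        simp only [Gphi, SimpleGraph.fromRel_adj, GphiRel] at hG
        rcases hG with ⟨-, (⟨h, _⟩ | ⟨j', i1, i2, h, h2, h3⟩) | (⟨h, _⟩ | ⟨j', i1, i2, h, h2, h3⟩)⟩
        · simp at h
        · simp at h
          exact absurd ⟨i2, by rw [h2, h.1]⟩ hd2
        · exact h
        · simp at h2
          exact absurd ⟨i1, by rw [h, h2.1]⟩ hd2
      rw [hi, this] at had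
      exact had.symm
    have hcomp : ∀ p q : Fin m × Fin 3, T.Adj none (some p) → T.Adj none (some q) →
        (lit p.1 p.2).1 = (lit q.1 q.2).1 → (lit p.1 p.2).2 = (lit q.1 q.2).2 := by
      intro p q hp hq h1
      by_contra h2
      have hne : p ≠ q := by rintro rfl; exact h2 rfl
      have := hcost _ _ (SimpleGraph.Walk.cons hp.symm (SimpleGraph.Walk.cons hq SimpleGraph.Walk.nil))
        (by simp [SimpleGraph.Walk.cons_isPath_iff, hne])
      simp only [walkCost, SimpleGraph.Walk.edges_cons, SimpleGraph.Walk.edges_nil, List.map_id,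
        chainCost] at this
      rw [Sym2.eq_swap, phiCost_spokes, if_pos ⟨h1, h2⟩] at this
      omega
    refine ⟨fun x => decide (∃ p : Fin m × Fin 3, T.Adj none (some p) ∧ lit p.1 p.2 = (x, true)), ?_⟩
    intro j
    obtain ⟨i, hi⟩ := hspoke j
    refine ⟨i, ?_⟩
    cases hb : (lit j i).2 with
    | true =>
      simp only [decide_eq_true_eq]
      exact ⟨(j, i), hi, Prod.ext rfl hb⟩
    | false =>
      simp only [decide_eq_false_iff_not]
      rintro ⟨p, hp, hpl⟩
      have := hcomp p (j, i) hp hi (by rw [hpl])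
      rw [hpl] at this
      simp [hb] at this
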